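/- Let p be a prime, let A be a finite p-group, and let α ∈ Irr(A) with α ≠ ᾱ. Let G = A ≀ C_p be the wreath product of A by a cyclic group C_p of order p acting on H = A × ⋯ × A (p copies) by cyclically permuting the coordinates. Let θ_0 ∈ Irr(H) be the character θ_0(a_0, a_1, …, a_{p−1}) = α(a_0), i.e. θ_0 = α × 1_A × ⋯ × 1_A, and set χ = θ_0^G. Then χ ∈ Irr(G), χ(1) = p·α(1), χ ≠ χ̄, and η(χ, χ̄) = η(α, ᾱ) + 2(p−1). -/

import Mathlib

open scoped Classical

/-- The inner product of two class functions on a finite group. -/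
noncomputable def charInner (G : Type) [Group G] (φ ψ : G → ℂ) : ℂ :=
  (Nat.card G : ℂ)⁻¹ * ∑ᶠ g : G, φ g * (starRingEnd ℂ) (ψ g)

/-- `χ` is an irreducible complex character of `G`. -/
def IsIrrChar (G : Type) [Group G] (χ : G → ℂ) : Prop :=
  ∃ V : FDRep ℂ G, CategoryTheory.Simple V ∧ V.character = χ

/-- The complex conjugate of a character. -/
def conjChar {G : Type} (χ : G → ℂ) : G → ℂ := fun g => (starRingEnd ℂ) (χ g)

/-- The set of irreducible constituents of a character `Θ` of `G`. -/
def constituents (G : Type) [Group G] (Θ : G → ℂ) : Set (G → ℂ) :=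
  {θ | IsIrrChar G θ ∧ charInner G θ Θ ≠ 0}

/-- `η χ ψ` : the number of distinct irreducible constituents of the product `χ ψ`. -/
noncomputable def eta (G : Type) [Group G] (χ ψ : G → ℂ) : ℕ :=
  (constituents G (χ * ψ)).ncard

/-- The character of `G` induced from the character `γ` of a subgroup `H`. -/
noncomputable def indChar {G : Type} [Group G] (H : Subgroup G) (γ : ↥H → ℂ) : G → ℂ :=
  fun g => (Nat.card ↥H : ℂ)⁻¹ *
    ∑ᶠ x : G, if h : x * g * x⁻¹ ∈ H then γ ⟨x * g * x⁻¹, h⟩ else 0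

/-- Restriction of a character of `G` to a subgroup `M`. -/
def resChar {G : Type} [Group G] (M : Subgroup G) (χ : G → ℂ) : ↥M → ℂ := fun m => χ (m : G)

/-- Restriction of a character of a subgroup `M` to a smaller subgroup `N ≤ M`. -/
def resChar₂ {G : Type} [Group G] {N M : Subgroup G} (h : N ≤ M) (μ : ↥M → ℂ) : ↥N → ℂ :=
  fun n => μ ⟨n.1, h n.2⟩

/-- The character of `M` induced from the character `ν` of `N`, where `N ≤ M` are
subgroups of `G`. -/
noncomputable def indCharSub {G : Type} [Group G] (N M : Subgroup G) (ν : ↥N → ℂ) : ↥M → ℂ :=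
  indChar (N.subgroupOf M) (fun x => ν ⟨x.1.1, x.2⟩)

/-- The inertia group (stabilizer) `G_ν` of a character `ν` of a normal subgroup `N` of `G`. -/
def inertia {G : Type} [Group G] (N : Subgroup G) (hN : N.Normal) (ν : ↥N → ℂ) : Subgroup G where
  carrier := {g : G | ∀ n : ↥N, ν (@MulAut.conjNormal G _ N hN g n) = ν n}
  one_mem' := by intro n; simp
  mul_mem' := by
    intro a b ha hb n
    rw [map_mul]
    exact (ha _).trans (hb n)
  inv_mem' := by
    intro a ha n
    have h := ha ((@MulAut.conjNormal G _ N hN a)⁻¹ n)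
    rw [MulAut.apply_inv_self] at h
    rw [map_inv]
    exact h.symm

/-- `M/N` is a chief factor of `G`. -/
structure IsChiefFactor {G : Type} [Group G] (N M : Subgroup G) : Prop where
  normalN : N.Normal
  normalM : M.Normal
  lt : N < M
  max : ∀ K : Subgroup G, K.Normal → N ≤ K → K ≤ M → K = N ∨ K = M

/-- The cyclic shift action of `C_p = Multiplicative (ZMod p)` on `A^p = (ZMod p → A)`:
the generator sends `(a_0, a_1, …, a_{p-1})` to `(a_{p-1}, a_0, …, a_{p-2})`. -/
def cycShift (p : ℕ) (A : Type) [Group A] :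
    Multiplicative (ZMod p) →* MulAut (ZMod p → A) where
  toFun c :=
    { toFun := fun f i => f (i - Multiplicative.toAdd c)
      invFun := fun f i => f (i + Multiplicative.toAdd c)
      left_inv := fun f => funext fun i => by simp
      right_inv := fun f => funext fun i => by simp
      map_mul' := fun f g => rfl }
  map_one' := by
    ext f i
    simp
  map_mul' := fun c d => by
    ext f i
    show f (i - Multiplicative.toAdd (c * d)) = f (i - Multiplicative.toAdd c - Multiplicative.toAdd d)
    rw [toAdd_mul, sub_sub, add_comm]

/-- The wreath product `A ≀ C_p`: the semidirect product of the base group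
`H = A^p` with `C_p` acting by cyclically permuting the coordinates. -/
abbrev WreathCp (p : ℕ) (A : Type) [Group A] : Type :=
  (ZMod p → A) ⋊[cycShift p A] Multiplicative (ZMod p)

/-- The base group `H = A^p` as a subgroup of `A ≀ C_p`. -/
def wreathBase (p : ℕ) (A : Type) [Group A] : Subgroup (WreathCp p A) :=
  (SemidirectProduct.rightHom :
    WreathCp p A →* Multiplicative (ZMod p)).ker

/-- The character `θ₀ = α × 1_A × ⋯ × 1_A` of the base group `H = A^p`,
`θ₀ (a_0, …, a_{p-1}) = α (a_0)`. -/
def wreathBaseChar (p : ℕ) (A : Type) [Group A] (α : A → ℂ) :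
    ↥(wreathBase p A) → ℂ :=
  fun x => α ((x : WreathCp p A).left 0)

/-- `φ` is a (not necessarily irreducible) complex character of `G`. -/
def IsChar (G : Type) [Group G] (φ : G → ℂ) : Prop :=
  ∃ V : FDRep ℂ G, V.character = φ

section Characters

variable {G : Type} [Group G]

theorem IsIrrChar.isChar {φ : G → ℂ} (h : IsIrrChar G φ) : IsChar G φ :=
  h.imp fun _ hV => hV.2

theorem isChar_trace {V : Type} [AddCommGroup V] [Module ℂ V] [FiniteDimensional ℂ V]
    (ρ : Representation ℂ G V) : IsChar G (fun g => LinearMap.trace ℂ V (ρ g)) :=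
  ⟨FDRep.of ρ, rfl⟩

theorem IsChar.mul {φ ψ : G → ℂ} (hφ : IsChar G φ) (hψ : IsChar G ψ) : IsChar G (φ * ψ) := by
  obtain ⟨V, rfl⟩ := hφ
  obtain ⟨W, rfl⟩ := hψ
  exact ⟨CategoryTheory.MonoidalCategoryStruct.tensorObj V W, FDRep.char_tensor V W⟩

theorem isChar_linear (l : G →* ℂ) : IsChar G l := by
  refine (congrArg (IsChar G) ?_).mp
    (isChar_trace (((Algebra.lmul ℂ ℂ : ℂ →* Module.End ℂ ℂ).comp l : Representation ℂ G ℂ)))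
  ext g
  simp [LinearMap.trace_eq_matrix_trace ℂ (Module.Basis.singleton Unit ℂ), Matrix.trace,
    LinearMap.toMatrix_apply]

theorem isChar_one : IsChar G 1 := isChar_linear 1

theorem IsChar.comp {K : Type} [Group K] {φ : G → ℂ} (hφ : IsChar G φ) (f : K →* G) :
    IsChar K (fun x => φ (f x)) := by
  obtain ⟨V, rfl⟩ := hφ
  exact isChar_trace (V.ρ.comp f)

open scoped ComplexOrder in
theorem IsChar.conj_apply [Finite G] {φ : G → ℂ} (hφ : IsChar G φ) (g : G) :
    (starRingEnd ℂ) (φ g) = φ g⁻¹ := by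
  have := Fintype.ofFinite G
  obtain ⟨V, rfl⟩ := hφ
  let b := Module.finBasis ℂ V
  let M : G → Matrix _ _ ℂ := fun x => LinearMap.toMatrix b b (V.ρ x)
  have hM (x y : G) : M (x * y) = M x * M y := by
    simp only [M, map_mul, LinearMap.toMatrix_mul]
  have hM1 : M 1 = 1 := by simp only [M, map_one, LinearMap.toMatrix_one]
  have htr (x : G) : V.character x = (M x).trace := LinearMap.trace_eq_matrix_trace ℂ b _
  let P := ∑ x : G, (M x).conjTranspose * M x
  have hP : P.PosDef := by
    have h1 : P = (M 1).conjTranspose * M 1 +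
        ∑ x ∈ Finset.univ.erase (1 : G), (M x).conjTranspose * M x :=
      (Finset.add_sum_erase _ _ (Finset.mem_univ _)).symm
    rw [h1, hM1, Matrix.conjTranspose_one, one_mul]
    exact Matrix.PosDef.one.add_posSemidef
      (Matrix.posSemidef_sum _ fun x _ => Matrix.posSemidef_conjTranspose_mul_self _)
  have hinv : (M g).conjTranspose * P * M g = P := by
    simp only [P, Finset.mul_sum, Finset.sum_mul]
    refine Fintype.sum_equiv (Equiv.mulRight g) _ _ fun x => ?_
    simp [hM, Matrix.conjTranspose_mul, mul_assoc]
  have hgg : M g * M g⁻¹ = 1 := by rw [← hM, mul_inv_cancel, hM1]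
  have hPu : IsUnit P.det := (Matrix.isUnit_iff_isUnit_det _).mp hP.isUnit
  have hc : (M g).conjTranspose = P * M g⁻¹ * P⁻¹ := by
    have : (M g).conjTranspose * P = P * M g⁻¹ := by
      rw [← mul_one ((M g).conjTranspose * P), ← hgg, ← mul_assoc, hinv]
    rw [← this, mul_assoc, Matrix.mul_nonsing_inv _ hPu, mul_one]
  rw [htr, htr, starRingEnd_apply, ← Matrix.trace_conjTranspose, hc, Matrix.trace_mul_comm,
    ← mul_assoc, Matrix.nonsing_inv_mul _ hPu, one_mul]

theorem IsChar.conj [Finite G] {φ : G → ℂ} (hφ : IsChar G φ) : IsChar G (conjChar φ) := by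
  have h : conjChar φ = fun g => φ g⁻¹ := funext hφ.conj_apply
  rw [h]
  obtain ⟨V, rfl⟩ := hφ
  exact ⟨FDRep.of (Representation.dual V.ρ), funext fun g => FDRep.char_dual V g⟩

theorem charInner_eq_sum [Fintype G] (φ ψ : G → ℂ) :
    charInner G φ ψ = (Nat.card G : ℂ)⁻¹ * ∑ g : G, φ g * (starRingEnd ℂ) (ψ g) := by
  rw [charInner, finsum_eq_sum_of_fintype]

theorem isIrrChar_iff [Finite G] {φ : G → ℂ} :
    IsIrrChar G φ ↔ IsChar G φ ∧ charInner G φ φ = 1 := by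
  have := Fintype.ofFinite G
  have key (V : FDRep ℂ G) : CategoryTheory.Simple V ↔
      charInner G V.character V.character = 1 := by
    have hc : (Nat.card G : ℂ) ≠ 0 := Nat.cast_ne_zero.mpr Nat.card_pos.ne'
    rw [FDRep.simple_iff_char_is_norm_one, charInner_eq_sum, inv_mul_eq_one₀ hc, eq_comm]
    simp only [IsChar.conj_apply ⟨V, rfl⟩]
  constructor
  · rintro ⟨V, hV, rfl⟩
    exact ⟨⟨V, rfl⟩, (key V).mp hV⟩
  · rintro ⟨⟨V, rfl⟩, h⟩
    exact ⟨V, (key V).mpr h, rfl⟩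

theorem charInner_irr [Finite G] {φ ψ : G → ℂ} (hφ : IsIrrChar G φ) (hψ : IsIrrChar G ψ) :
    charInner G φ ψ = if φ = ψ then 1 else 0 := by
  split_ifs with h
  · exact h ▸ (isIrrChar_iff.mp hφ).2
  · have := Fintype.ofFinite G
    obtain ⟨V, hV, rfl⟩ := hφ
    obtain ⟨W, hW, rfl⟩ := hψ
    have hc : (Nat.card G : ℂ) ≠ 0 := Nat.cast_ne_zero.mpr Nat.card_pos.ne'
    have := invertibleOfNonzero hc
    have horth := FDRep.char_orthonormal V W
    rw [if_neg fun ⟨e⟩ => h (FDRep.char_iso e)] at horth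
    simpa only [charInner_eq_sum, IsChar.conj_apply ⟨W, rfl⟩] using horth

theorem charInner_sum_right [Finite G] {ι : Type*} [Fintype ι] (θ : G → ℂ) (m : ι → ℂ)
    (Φ : ι → G → ℂ) :
    charInner G θ (∑ i, m i • Φ i) =
      ∑ i, (starRingEnd ℂ) (m i) * charInner G θ (Φ i) := by
  have := Fintype.ofFinite G
  simp only [charInner_eq_sum, Finset.sum_apply, Pi.smul_apply, smul_eq_mul, map_sum, map_mul,
    Finset.mul_sum]
  rw [Finset.sum_comm]
  exact Finset.sum_congr rfl fun i _ => Finset.sum_congr rfl fun g _ => by ring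

theorem charInner_sum_irr [Finite G] {ι : Type*} [Fintype ι] {m : ι → ℂ} {Φ : ι → G → ℂ}
    (hΦ : ∀ i, IsIrrChar G (Φ i)) {θ : G → ℂ} (hθ : IsIrrChar G θ) :
    charInner G θ (∑ i, m i • Φ i) = ∑ i, if θ = Φ i then (starRingEnd ℂ) (m i) else 0 := by
  rw [charInner_sum_right]
  exact Finset.sum_congr rfl fun i _ => by rw [charInner_irr hθ (hΦ i)]; simp

theorem constituents_sum [Finite G] {ι : Type*} [Fintype ι] {m : ι → ℂ} {Φ : ι → G → ℂ}
    (hΦ : ∀ i, IsIrrChar G (Φ i)) (hinj : Function.Injective Φ) (hm : ∀ i, m i ≠ 0) :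
    constituents G (∑ i, m i • Φ i) = Set.range Φ := by
  ext θ
  constructor
  · rintro ⟨hθ, h⟩
    rw [charInner_sum_irr hΦ hθ] at h
    obtain ⟨i, -, hi⟩ := Finset.exists_ne_zero_of_sum_ne_zero h
    exact ⟨i, by_contra fun hne => hi (if_neg fun e => hne e.symm)⟩
  · rintro ⟨i, rfl⟩
    refine ⟨hΦ i, ?_⟩
    rw [charInner_sum_irr hΦ (hΦ i)]
    simp [hinj.eq_iff, hm]

theorem ncard_constituents_sum [Finite G] {ι : Type*} [Fintype ι] {m : ι → ℂ} {Φ : ι → G → ℂ}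
    (hΦ : ∀ i, IsIrrChar G (Φ i)) (hinj : Function.Injective Φ) (hm : ∀ i, m i ≠ 0) :
    (constituents G (∑ i, m i • Φ i)).ncard = Fintype.card ι := by
  rw [constituents_sum hΦ hinj hm, ← Set.image_univ, Set.ncard_image_of_injective _ hinj,
    Set.ncard_univ, Nat.card_eq_fintype_card]

theorem isIrrChar_linear [Finite G] (l : G →* ℂ) : IsIrrChar G l := by
  have := Fintype.ofFinite G
  refine isIrrChar_iff.mpr ⟨isChar_linear l, ?_⟩
  have h (g : G) : l g * l g⁻¹ = 1 := by rw [← map_mul, mul_inv_cancel, map_one]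
  simp only [charInner_eq_sum, (isChar_linear l).conj_apply, h]
  simp

theorem isIrrChar_one [Finite G] : IsIrrChar G 1 := isIrrChar_linear 1

theorem Representation.isIrrChar_trace [Finite G] {V : Type} [AddCommGroup V] [Module ℂ V]
    [FiniteDimensional ℂ V] (ρ : Representation ℂ G V) [ρ.IsIrreducible] :
    IsIrrChar G (fun g => LinearMap.trace ℂ V (ρ g)) := by
  have := Fintype.ofFinite G
  have hc : (Nat.card G : ℂ) ≠ 0 := Nat.cast_ne_zero.mpr Nat.card_pos.ne'
  have := invertibleOfNonzero hc
  refine isIrrChar_iff.mpr ⟨isChar_trace ρ, ?_⟩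
  have h := Representation.char_orthonormal ρ ρ
  rw [if_pos ⟨Representation.Equiv.refl _⟩] at h
  simp only [charInner_eq_sum, (isChar_trace ρ).conj_apply]
  exact_mod_cast h

/-- A character is a sum of irreducible characters. -/
theorem Representation.exists_trace_eq_sum [Finite G] {V : Type} [AddCommGroup V] [Module ℂ V]
    [FiniteDimensional ℂ V] (ρ : Representation ℂ G V) :
    ∃ l : Multiset (G → ℂ), (∀ φ ∈ l, IsIrrChar G φ) ∧
      (fun g => LinearMap.trace ℂ V (ρ g)) = l.sum := by
  induction hn : Module.finrank ℂ V using Nat.strong_induction_on generalizing V with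
  | _ n ih =>
    rcases subsingleton_or_nontrivial V with hV | hV
    · refine ⟨0, by simp, funext fun g => ?_⟩
      rw [Subsingleton.elim (ρ g) 0]
      simp
    by_cases hirr : ρ.IsIrreducible
    · exact ⟨{_}, by simpa using ρ.isIrrChar_trace, by simp⟩
    have : ∃ W : Subrepresentation ρ, W ≠ ⊥ ∧ W ≠ ⊤ := by
      by_contra! h
      have : Nontrivial (Subrepresentation ρ) :=
        ⟨⊥, ⊤, fun e => bot_ne_top (α := Submodule ℂ V)
          (congrArg Subrepresentation.toSubmodule e)⟩
      exact hirr ⟨fun W => or_iff_not_imp_left.mpr (h W)⟩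
    obtain ⟨U, hU, hU'⟩ := this
    have : NeZero (Nat.card G : ℂ) := ⟨Nat.cast_ne_zero.mpr Nat.card_pos.ne'⟩
    have hss : ρ.IsSemisimpleRepresentation := inferInstance
    obtain ⟨W, hUW⟩ := exists_isCompl U
    have hcompl : IsCompl U.toSubmodule W.toSubmodule := by
      refine ⟨disjoint_iff.mpr ?_, codisjoint_iff.mpr ?_⟩
      · exact congrArg Subrepresentation.toSubmodule hUW.inf_eq_bot
      · exact congrArg Subrepresentation.toSubmodule hUW.sup_eq_top
    have hlt (S : Subrepresentation ρ) (hS : S ≠ ⊤) : Module.finrank ℂ S.toSubmodule < n :=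
      hn ▸ Submodule.finrank_lt fun e => hS (Subrepresentation.toSubmodule_injective e)
    have hW : W ≠ ⊤ := fun e => hU (by simpa [e] using hUW.inf_eq_bot)
    obtain ⟨l₁, hl₁, h₁⟩ := ih _ (hlt U hU') U.toRepresentation rfl
    obtain ⟨l₂, hl₂, h₂⟩ := ih _ (hlt W hW) W.toRepresentation rfl
    refine ⟨l₁ + l₂, fun φ hφ => (Multiset.mem_add.mp hφ).elim (hl₁ φ) (hl₂ φ), ?_⟩
    rw [Multiset.sum_add, ← h₁, ← h₂]
    funext g
    have hint : DirectSum.IsInternal fun b : Bool => (cond b U W).toSubmodule :=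
      (DirectSum.isInternal_submodule_iff_isCompl _ (i := true) (j := false) (by simp)
        (by ext b; cases b <;> simp)).mpr hcompl
    rw [LinearMap.trace_eq_sum_trace_restrict hint
      (fun b => (cond b U W).apply_mem_toSubmodule g), Fintype.sum_bool]
    rfl

theorem IsChar.exists_eq_sum [Finite G] {Θ : G → ℂ} (hΘ : IsChar G Θ) :
    ∃ (s : Finset (G → ℂ)) (m : (G → ℂ) → ℂ), (∀ φ ∈ s, IsIrrChar G φ ∧ m φ ≠ 0) ∧
      Θ = ∑ φ ∈ s, m φ • φ := by
  obtain ⟨V, rfl⟩ := hΘ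
  obtain ⟨l, hl, h⟩ := Representation.exists_trace_eq_sum V.ρ
  refine ⟨l.toFinset, fun φ => l.count φ, fun φ hφ => ?_, ?_⟩
  · rw [Multiset.mem_toFinset] at hφ
    exact ⟨hl φ hφ, Nat.cast_ne_zero.mpr (Multiset.count_pos.mpr hφ).ne'⟩
  · simp only [Nat.cast_smul_eq_nsmul]
    rw [← Finset.sum_multiset_count, ← h]
    rfl

theorem IsIrrChar.conj [Finite G] {α : G → ℂ} (hα : IsIrrChar G α) :
    IsIrrChar G (conjChar α) := by
  have := Fintype.ofFinite G
  obtain ⟨h, h'⟩ := isIrrChar_iff.mp hα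
  refine isIrrChar_iff.mpr ⟨h.conj, ?_⟩
  rw [← h', charInner_eq_sum, charInner_eq_sum]
  simp [conjChar, mul_comm]

end Characters

theorem conjChar_conjChar {A : Type} (α : A → ℂ) : conjChar (conjChar α) = α :=
  funext fun _ => Complex.conj_conj _

theorem conjChar_one {A : Type} : conjChar (1 : A → ℂ) = 1 :=
  funext fun _ => map_one _

theorem prod_mulSingle_apply {p : ℕ} [NeZero p] {A : Type} (β : A → ℂ) (j : ZMod p)
    (x : ZMod p → A) :
    ∏ k, (Pi.mulSingle j β : ZMod p → A → ℂ) k (x k) = β (x j) := by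
  rw [Finset.prod_eq_single j] <;> simp +contextual

theorem card_wreathBase {p : ℕ} {A : Type} [Group A] :
    Nat.card (wreathBase p A) = Nat.card (ZMod p → A) := by
  rw [wreathBase, ← SemidirectProduct.range_inl_eq_ker_rightHom]
  exact Nat.card_congr (MonoidHom.ofInjective SemidirectProduct.inl_injective).toEquiv.symm

theorem isIrrChar_mulSingle {p : ℕ} {A : Type} [Group A] [Finite A] {β : A → ℂ}
    (hβ : IsIrrChar A β) (j k : ZMod p) :
    IsIrrChar A ((Pi.mulSingle j β : ZMod p → A → ℂ) k) := by
  rw [Pi.mulSingle_apply]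
  split_ifs
  exacts [hβ, isIrrChar_one]

theorem isIrrChar_mulSingle_mul {p : ℕ} {A : Type} [Group A] [Finite A] {β γ : A → ℂ}
    (hβ : IsIrrChar A β) (hγ : IsIrrChar A γ) {j : ZMod p} (hj : j ≠ 0) (k : ZMod p) :
    IsIrrChar A ((Pi.mulSingle 0 β * Pi.mulSingle j γ : ZMod p → A → ℂ) k) := by
  rw [Pi.mul_apply]
  by_cases hk : k = 0
  · rw [Pi.mulSingle_eq_of_ne (hk.trans_ne hj.symm), mul_one]
    exact isIrrChar_mulSingle hβ 0 k
  · rw [Pi.mulSingle_eq_of_ne hk, one_mul]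
    exact isIrrChar_mulSingle hγ j k

section Wreath

variable {p : ℕ} [NeZero p] {A : Type} [Group A]

/-- The function on `A ≀ C_p` which vanishes outside the base group and is the sum of the
conjugates of `∏ k, f k (a_k)` on it: the character induced from `∏ k, f k (a_k)`. -/
noncomputable def wreathInd (f : ZMod p → A → ℂ) : WreathCp p A → ℂ :=
  fun g => if g.right = 1 then ∑ i, ∏ k, f k (g.left (k + i)) else 0

/-- The representation of `A ≀ C_p` induced from a representation of the base group. -/
def wreathIndRep {V : Type} [AddCommGroup V] [Module ℂ V]
    (ρ : Representation ℂ (ZMod p → A) V) :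
    Representation ℂ (WreathCp p A) (ZMod p → V) where
  toFun g := LinearMap.pi fun i =>
    (ρ fun k => g.left (k + i)).comp (LinearMap.proj (i - Multiplicative.toAdd g.right))
  map_one' := by
    ext i v j
    simp [← Pi.one_def]
  map_mul' g h := by
    refine LinearMap.ext fun F => funext fun i => ?_
    have hρ : (fun k => (g * h).left (k + i)) = (fun k => g.left (k + i)) *
        fun k => h.left (k + (i - Multiplicative.toAdd g.right)) := by
      funext k
      simp [cycShift, add_sub_assoc]
    change (ρ fun k => (g * h).left (k + i)) _ = (ρ fun k => g.left (k + i)) (ρ _ _)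
    rw [hρ, map_mul]
    simp [sub_sub]

theorem trace_wreathIndRep {V : Type} [AddCommGroup V] [Module ℂ V] [FiniteDimensional ℂ V]
    (ρ : Representation ℂ (ZMod p → A) V) (g : WreathCp p A) :
    LinearMap.trace ℂ _ (wreathIndRep ρ g) =
      if g.right = 1 then ∑ i, LinearMap.trace ℂ V (ρ fun k => g.left (k + i)) else 0 := by
  let b := Module.finBasis ℂ V
  rw [LinearMap.trace_eq_matrix_trace ℂ (Pi.basis fun _ : ZMod p => b), Matrix.trace,
    Fintype.sum_sigma]
  have hdiag (i : ZMod p) (j) :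
      LinearMap.toMatrix (Pi.basis fun _ : ZMod p => b) (Pi.basis fun _ : ZMod p => b)
        (wreathIndRep ρ g) ⟨i, j⟩ ⟨i, j⟩ =
      if g.right = 1 then LinearMap.toMatrix b b (ρ fun k => g.left (k + i)) j j else 0 := by
    have : i - Multiplicative.toAdd g.right = i ↔ g.right = 1 := by
      rw [sub_eq_self, toAdd_eq_zero]
    rw [LinearMap.toMatrix_apply, LinearMap.toMatrix_apply, Pi.basis_repr, Pi.basis_apply]
    simp only [wreathIndRep, MonoidHom.coe_mk, OneHom.coe_mk, LinearMap.pi_apply,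
      LinearMap.comp_apply, LinearMap.proj_apply, Pi.single_apply, this]
    split_ifs <;> simp
  simp only [Matrix.diag_apply, hdiag]
  split_ifs
  · simp only [LinearMap.trace_eq_matrix_trace ℂ b, Matrix.trace, Matrix.diag_apply]
  · simp

theorem isChar_prod {f : ZMod p → A → ℂ} (hf : ∀ k, IsChar A (f k)) :
    IsChar (ZMod p → A) fun h => ∏ k, f k (h k) := by
  have : IsChar (ZMod p → A) (∏ k, fun h : ZMod p → A => f k (h k)) :=
    Finset.prod_induction _ _ (fun _ _ => IsChar.mul) isChar_one
      fun k _ => (hf k).comp (Pi.evalMonoidHom (fun _ : ZMod p => A) k)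
  convert this using 1
  ext h
  simp

theorem isChar_wreathInd {f : ZMod p → A → ℂ} (hf : ∀ k, IsChar A (f k)) :
    IsChar (WreathCp p A) (wreathInd f) := by
  obtain ⟨V, hV⟩ := isChar_prod hf
  convert isChar_trace (wreathIndRep V.ρ) using 1
  ext g
  rw [trace_wreathIndRep, wreathInd]
  refine if_congr Iff.rfl (Finset.sum_congr rfl fun i _ => ?_) rfl
  exact (congrFun hV fun k => g.left (k + i)).symm

theorem card_wreath : Nat.card (WreathCp p A) = Nat.card A ^ p * p := by
  rw [SemidirectProduct.card, Nat.card_fun, Nat.card_zmod, Nat.card_congr Multiplicative.toAdd,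
    Nat.card_zmod]

instance [Finite A] : Finite (WreathCp p A) :=
  Finite.of_equiv _ SemidirectProduct.equivProd.symm

theorem charInner_wreathInd [Finite A] {f f' : ZMod p → A → ℂ} (hf : ∀ k, IsIrrChar A (f k))
    (hf' : ∀ k, IsIrrChar A (f' k)) :
    charInner (WreathCp p A) (wreathInd f) (wreathInd f') =
      (p : ℂ)⁻¹ * ∑ i : ZMod p, ∑ j : ZMod p,
        if ∀ k, f (k - i) = f' (k - j) then 1 else 0 := by
  have := Fintype.ofFinite A
  have := Fintype.ofFinite (WreathCp p A)
  have hA : (Nat.card A : ℂ) ≠ 0 := Nat.cast_ne_zero.mpr Nat.card_pos.ne'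
  have hterm (i j : ZMod p) : ∑ h : ZMod p → A, (∏ k, f k (h (k + i))) *
      ∏ k, (starRingEnd ℂ) (f' k (h (k + j))) =
      (Nat.card A : ℂ) ^ p * if ∀ k, f (k - i) = f' (k - j) then 1 else 0 := by
    have h1 (h : ZMod p → A) : (∏ k, f k (h (k + i))) *
        ∏ k, (starRingEnd ℂ) (f' k (h (k + j))) =
        ∏ k, f (k - i) (h k) * (starRingEnd ℂ) (f' (k - j) (h k)) := by
      rw [Finset.prod_mul_distrib]
      congr 1
      · exact Fintype.prod_equiv (Equiv.addRight i) _ _ fun k => by simp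
      · exact Fintype.prod_equiv (Equiv.addRight j) _ _ fun k => by simp
    have h2 (k : ZMod p) : ∑ a, f (k - i) a * (starRingEnd ℂ) (f' (k - j) a) =
        Nat.card A * if f (k - i) = f' (k - j) then 1 else 0 := by
      have h := charInner_irr (hf (k - i)) (hf' (k - j))
      rw [charInner_eq_sum, inv_mul_eq_iff_eq_mul₀ hA] at h
      rw [h]
      congr!
    simp only [h1]
    have h3 := Finset.prod_univ_sum (fun _ : ZMod p => (Finset.univ : Finset A))
      fun k a => f (k - i) a * (starRingEnd ℂ) (f' (k - j) a)
    rw [Fintype.piFinset_univ] at h3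
    rw [← h3]
    simp only [h2, Finset.prod_mul_distrib, Finset.prod_const, Finset.card_univ, ZMod.card]
    congr 1
    simp [Finset.prod_ite_zero]
  rw [charInner_eq_sum, card_wreath, ← SemidirectProduct.equivProd.symm.sum_comp,
    Fintype.sum_prod_type]
  have hsum (h : ZMod p → A) : ∑ c : Multiplicative (ZMod p),
      wreathInd f (SemidirectProduct.equivProd.symm (h, c)) *
        (starRingEnd ℂ) (wreathInd f' (SemidirectProduct.equivProd.symm (h, c))) =
      ∑ i, ∑ j, (∏ k, f k (h (k + i))) * ∏ k, (starRingEnd ℂ) (f' k (h (k + j))) := by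
    rw [Finset.sum_eq_single 1]
    · simp [wreathInd, SemidirectProduct.equivProd, Finset.sum_mul_sum]
    · intro c _ hc
      simp [wreathInd, SemidirectProduct.equivProd, hc]
    · simp
  simp only [hsum]
  rw [Finset.sum_comm]
  simp only [Finset.sum_comm (s := (Finset.univ : Finset (ZMod p → A))), hterm]
  simp only [← Finset.mul_sum, Nat.cast_mul, Nat.cast_pow]
  field_simp
  congr!

theorem isIrrChar_wreathInd [Finite A] {f : ZMod p → A → ℂ} (hf : ∀ k, IsIrrChar A (f k))
    (hne : ∀ i, (∀ k, f (k + i) = f k) → i = 0) :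
    IsIrrChar (WreathCp p A) (wreathInd f) := by
  refine isIrrChar_iff.mpr ⟨isChar_wreathInd fun k => (hf k).isChar, ?_⟩
  have h (i j : ZMod p) : (∀ k, f (k - i) = f (k - j)) ↔ i = j := by
    refine ⟨fun h => ?_, fun h => by simp [h]⟩
    have := hne (j - i) fun k => by rw [← add_sub_assoc, h, add_sub_cancel_right]
    exact (sub_eq_zero.mp this).symm
  rw [charInner_wreathInd hf hf]
  simp [h, NeZero.ne p]

theorem wreathInd_ne [Finite A] {f f' : ZMod p → A → ℂ} (hf : ∀ k, IsIrrChar A (f k))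
    (hf' : ∀ k, IsIrrChar A (f' k)) (hirr : IsIrrChar (WreathCp p A) (wreathInd f))
    (hne : ∀ i, ¬ ∀ k, f (k + i) = f' k) : wreathInd f ≠ wreathInd f' := by
  intro e
  have h1 := (isIrrChar_iff.mp hirr).2
  nth_rewrite 2 [e] at h1
  have h (i j : ZMod p) : ¬ ∀ k, f (k - i) = f' (k - j) := fun h =>
    hne (j - i) fun k => by rw [← add_sub_assoc, h, add_sub_cancel_right]
  rw [charInner_wreathInd hf hf'] at h1
  simp [h] at h1

theorem wreathInd_mulSingle (β : A → ℂ) (g : WreathCp p A) :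
    wreathInd (Pi.mulSingle 0 β) g = if g.right = 1 then ∑ i, β (g.left i) else 0 := by
  rw [wreathInd]
  refine if_congr Iff.rfl (Finset.sum_congr rfl fun i _ => ?_) rfl
  rw [prod_mulSingle_apply β 0 fun k => g.left (k + i), zero_add]

theorem wreathInd_mulSingle_mul (β γ : A → ℂ) (j : ZMod p) (g : WreathCp p A) :
    wreathInd (Pi.mulSingle 0 β * Pi.mulSingle j γ) g =
      if g.right = 1 then ∑ i, β (g.left i) * γ (g.left (j + i)) else 0 := by
  rw [wreathInd]
  refine if_congr Iff.rfl (Finset.sum_congr rfl fun i _ => ?_) rfl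
  simp only [Pi.mul_apply, Finset.prod_mul_distrib]
  rw [prod_mulSingle_apply β 0 fun k => g.left (k + i),
    prod_mulSingle_apply γ j fun k => g.left (k + i), zero_add]

theorem indChar_wreathBase [Finite A] {α : A → ℂ} (hα : IsChar A α) :
    indChar (wreathBase p A) (wreathBaseChar p A α) = wreathInd (Pi.mulSingle 0 α) := by
  have := Fintype.ofFinite A
  have := Fintype.ofFinite (WreathCp p A)
  have hcl (a b : A) : α (b * a * b⁻¹) = α a := by
    obtain ⟨V, rfl⟩ := hα
    exact V.char_conj a b
  funext g
  have hmem (x : WreathCp p A) : x * g * x⁻¹ ∈ wreathBase p A ↔ g.right = 1 := by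
    simp [wreathBase, MonoidHom.mem_ker]
  rw [indChar, wreathInd_mulSingle, finsum_eq_sum_of_fintype, card_wreathBase]
  by_cases hg : g.right = 1
  · have hval (x : WreathCp p A) :
        (if h : x * g * x⁻¹ ∈ wreathBase p A then
          wreathBaseChar p A α ⟨x * g * x⁻¹, h⟩ else 0) =
          α (g.left (-Multiplicative.toAdd x.right)) := by
      rw [dif_pos ((hmem x).mpr hg), wreathBaseChar]
      simp [cycShift, hg, hcl]
    simp only [hval, if_pos hg]
    rw [← SemidirectProduct.equivProd.symm.sum_comp, Fintype.sum_prod_type]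
    have hN : (Nat.card (ZMod p → A) : ℂ) ≠ 0 := Nat.cast_ne_zero.mpr Nat.card_pos.ne'
    change _ * ∑ _h : ZMod p → A, ∑ c : Multiplicative (ZMod p),
      α (g.left (-Multiplicative.toAdd c)) = _
    rw [Finset.sum_const, Finset.card_univ, ← Nat.card_eq_fintype_card, nsmul_eq_mul,
      inv_mul_cancel_left₀ hN]
    exact Fintype.sum_equiv (Multiplicative.toAdd.trans (Equiv.neg _)) _ _ fun c => rfl
  · simp [hmem, hg]

theorem isIrrChar_wreathInd_mulSingle [Finite A] {β : A → ℂ} (hβ : IsIrrChar A β) (h1 : β ≠ 1) :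
    IsIrrChar (WreathCp p A) (wreathInd (Pi.mulSingle 0 β)) := by
  refine isIrrChar_wreathInd (isIrrChar_mulSingle hβ 0) fun i h => ?_
  have := h 0
  by_contra hi
  simp [hi, h1.symm] at this

/-- The irreducible constituents of `χ χ̄`: the linear characters of `C_p`, the characters induced
from `β × 1 × ⋯ × 1` with `β ∈ s`, and those induced from `α × ⋯ × ᾱ × ⋯ × 1`. -/
noncomputable def wreathConstituent (α : A → ℂ) (s : Finset (A → ℂ)) :
    AddChar (ZMod p) ℂ ⊕ s ⊕ (Finset.univ.erase (0 : ZMod p)) → WreathCp p A → ℂ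
  | .inl ψ => ψ.toMonoidHom.comp SemidirectProduct.rightHom
  | .inr (.inl β) => wreathInd (Pi.mulSingle 0 β.1)
  | .inr (.inr j) => wreathInd (Pi.mulSingle 0 α * Pi.mulSingle j.1 (conjChar α))

theorem isIrrChar_wreathInd_pair [Finite A] {α : A → ℂ} (hα : IsIrrChar A α)
    (hne : α ≠ conjChar α) {j : ZMod p} (hj : j ≠ 0) :
    IsIrrChar (WreathCp p A) (wreathInd (Pi.mulSingle 0 α * Pi.mulSingle j (conjChar α))) := by
  have h1 : α ≠ 1 := fun e => hne (by rw [e, conjChar_one])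
  refine isIrrChar_wreathInd (isIrrChar_mulSingle_mul hα hα.conj hj) fun i h => ?_
  have := h 0
  by_contra hi
  by_cases hij : i = j <;> simp [hi, hij, hj, hj.symm, h1.symm, hne.symm] at this

theorem isIrrChar_wreathConstituent [Finite A] {α : A → ℂ} (hα : IsIrrChar A α)
    (hne : α ≠ conjChar α) {s : Finset (A → ℂ)} (hs : ∀ β ∈ s, IsIrrChar A β) (hs1 : 1 ∉ s) (i) :
    IsIrrChar (WreathCp p A) (wreathConstituent α s i) := by
  match i with
  | .inl ψ => exact isIrrChar_linear _
  | .inr (.inl β) =>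
    exact isIrrChar_wreathInd_mulSingle (hs _ β.2) fun e => hs1 (e ▸ β.2)
  | .inr (.inr j) => exact isIrrChar_wreathInd_pair hα hne (Finset.ne_of_mem_erase j.2)

theorem wreathConstituent_injective [Finite A] (hp : 1 < p) {α : A → ℂ} (hα : IsIrrChar A α)
    (hne : α ≠ conjChar α) {s : Finset (A → ℂ)} (hs : ∀ β ∈ s, IsIrrChar A β) (hs1 : 1 ∉ s) :
    Function.Injective (wreathConstituent (p := p) α s) := by
  have h1 : α ≠ 1 := fun e => hne (by rw [e, conjChar_one])
  have h1' : conjChar α ≠ 1 := fun e => h1 (by rw [← conjChar_conjChar α, e, conjChar_one])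
  have hirr := isIrrChar_wreathConstituent (p := p) hα hne hs hs1
  have : Fact (1 < p) := ⟨hp⟩
  have hlin (ψ : AddChar (ZMod p) ℂ) (f : ZMod p → A → ℂ) :
      ((ψ.toMonoidHom.comp SemidirectProduct.rightHom : WreathCp p A →* ℂ) : _ → ℂ) ≠
        wreathInd f := by
    intro e
    have := congrFun e (SemidirectProduct.inr (Multiplicative.ofAdd 1))
    exact (ψ.val_isUnit 1).ne_zero (by simpa [wreathInd] using this)
  have hsp (β : s) (j : Finset.univ.erase (0 : ZMod p)) :
      wreathConstituent (p := p) α s (.inr (.inl β)) ≠ wreathConstituent α s (.inr (.inr j)) := by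
    have hj := Finset.ne_of_mem_erase j.2
    refine wreathInd_ne (isIrrChar_mulSingle (hs _ β.2) 0)
      (isIrrChar_mulSingle_mul hα hα.conj hj) (hirr (.inr (.inl β))) fun i h => ?_
    have h0 := h 0
    by_cases hi : i = 0
    · have hj' := h j
      simp [hi, hj, h1'.symm] at hj'
    · simp [hi, hj.symm, h1.symm] at h0
  rintro (ψ | β | j) (ψ' | β' | j') h
  · congr 1
    refine DFunLike.ext _ _ fun c => ?_
    have := congrFun h (SemidirectProduct.inr (Multiplicative.ofAdd c))
    simpa [wreathConstituent] using this
  · exact (hlin _ _ h).elim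
  · exact (hlin _ _ h).elim
  · exact (hlin _ _ h.symm).elim
  · by_contra hββ
    refine wreathInd_ne (isIrrChar_mulSingle (hs _ β.2) 0) (isIrrChar_mulSingle (hs _ β'.2) 0)
      (hirr (.inr (.inl β))) (fun i h => ?_) h
    have h0 := h 0
    by_cases hi : i = 0
    · simp only [hi, zero_add, Pi.mulSingle_eq_same] at h0
      exact hββ (by rw [Subtype.ext h0])
    · simp only [zero_add, Pi.mulSingle_eq_same, Pi.mulSingle_eq_of_ne hi] at h0
      exact hs1 (h0 ▸ β'.2)
  · exact (hsp _ _ h).elim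
  · exact (hlin _ _ h.symm).elim
  · exact (hsp _ _ h.symm).elim
  · by_contra hjj
    have hj := Finset.ne_of_mem_erase j.2
    have hj' := Finset.ne_of_mem_erase j'.2
    have hjj' : j'.1 ≠ j.1 := fun e => hjj (by rw [Subtype.ext e])
    refine wreathInd_ne (isIrrChar_mulSingle_mul hα hα.conj hj)
      (isIrrChar_mulSingle_mul hα hα.conj hj') (hirr (.inr (.inr j))) (fun i h => ?_) h
    have h0 := h 0
    by_cases hi : i = 0
    · have := h j'
      simp [hi, hj', hjj', h1'.symm] at this
    · by_cases hij : i = j <;>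
        simp [hi, hij, hj, hj'.symm, h1.symm, hne.symm] at h0

theorem wreathInd_mul_conj {α : A → ℂ} {s : Finset (A → ℂ)} {m : (A → ℂ) → ℂ} (h1 : 1 ∈ s)
    (hαs : α * conjChar α = ∑ β ∈ s, m β • β) :
    wreathInd (p := p) (Pi.mulSingle 0 α) * conjChar (wreathInd (Pi.mulSingle 0 α)) =
      ∑ i, Sum.elim (fun _ => m 1) (Sum.elim (fun β => m β.1) fun _ => 1) i •
        wreathConstituent α (s.erase 1) i := by
  funext g
  simp only [Fintype.sum_sum_type, Finset.sum_apply, Pi.smul_apply, Pi.mul_apply,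
    Sum.elim_inl, Sum.elim_inr, wreathConstituent, wreathInd_mulSingle_mul, wreathInd_mulSingle,
    conjChar, smul_eq_mul, one_mul, ← Finset.mul_sum]
  have hψ : ∑ ψ : AddChar (ZMod p) ℂ,
      (ψ.toMonoidHom.comp (SemidirectProduct.rightHom : WreathCp p A →* _)) g =
      if g.right = 1 then (p : ℂ) else 0 := by
    simpa [ZMod.card] using AddChar.sum_apply_eq_ite (Multiplicative.toAdd g.right)
  rw [hψ]
  by_cases hg : g.right = 1
  · simp only [if_pos hg]
    rw [Finset.sum_coe_sort (s.erase 1) fun β => m β * ∑ i, β (g.left i),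
      Finset.sum_coe_sort (Finset.univ.erase (0 : ZMod p)) fun j =>
        ∑ i, α (g.left i) * (starRingEnd ℂ) (α (g.left (j + i)))]
    have hs := Finset.add_sum_erase s (fun β => m β * ∑ i, β (g.left i)) h1
    have hα0 : ∑ β ∈ s, m β * ∑ i, β (g.left i) =
        ∑ i, α (g.left i) * (starRingEnd ℂ) (α (g.left (0 + i))) := by
      simp only [Finset.mul_sum]
      rw [Finset.sum_comm]
      refine Finset.sum_congr rfl fun i _ => ?_
      have := congrFun hαs (g.left i)
      simpa [conjChar] using this.symm
    have hp : m 1 * p = m 1 * ∑ i : ZMod p, (1 : A → ℂ) (g.left i) := by simp [ZMod.card]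
    rw [← add_assoc, hp, hs, hα0, Finset.add_sum_erase Finset.univ (fun j : ZMod p =>
        ∑ i, α (g.left i) * (starRingEnd ℂ) (α (g.left (j + i)))) (Finset.mem_univ _),
      Finset.sum_comm, map_sum, Finset.sum_mul_sum]
    exact Finset.sum_congr rfl fun i _ =>
      (Fintype.sum_equiv (Equiv.addRight i) _ _ fun j => rfl).symm
  · simp [hg]

end Wreath

/-- **Proposition.** Let `p` be a prime, `A` a finite `p`-group, `α ∈ Irr(A)` with
`α ≠ ᾱ`. Let `G = A ≀ C_p`, `θ₀ = α × 1_A × ⋯ × 1_A ∈ Irr(H)` for the base group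
`H = A^p`, and `χ = θ₀^G`. Then `χ ∈ Irr(G)`, `χ(1) = p α(1)`, `χ ≠ χ̄`, and
`η(χ, χ̄) = η(α, ᾱ) + 2(p-1)`. -/
theorem wreath_product_eta {p : ℕ} (hp : p.Prime)
    (A : Type) [Group A] [Finite A] (hA : IsPGroup p A)
    (α : A → ℂ) (hα : IsIrrChar A α) (hαne : α ≠ conjChar α)
    (χ : WreathCp p A → ℂ)
    (hχdef : χ = indChar (wreathBase p A) (wreathBaseChar p A α)) :
    IsIrrChar (WreathCp p A) χ ∧
    χ 1 = (p : ℂ) * α 1 ∧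
    χ ≠ conjChar χ ∧
    eta (WreathCp p A) χ (conjChar χ) = eta A α (conjChar α) + 2 * (p - 1) := by
  have : NeZero p := ⟨hp.ne_zero⟩
  have h1 : α ≠ 1 := fun e => hαne (by rw [e, conjChar_one])
  rw [indChar_wreathBase hα.isChar] at hχdef
  subst hχdef
  refine ⟨isIrrChar_wreathInd_mulSingle hα h1, ?_, fun e => hαne ?_, ?_⟩
  · simp [wreathInd_mulSingle, ZMod.card]
  · funext a
    have hα1 : (starRingEnd ℂ) (α 1) = α 1 := by rw [hα.isChar.conj_apply, inv_one]
    have := congrFun e (SemidirectProduct.inl (Pi.mulSingle 0 a))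
    simp only [conjChar, wreathInd_mulSingle, SemidirectProduct.right_inl, if_true, map_sum,
      SemidirectProduct.left_inl] at this
    rw [← Finset.add_sum_erase _ _ (Finset.mem_univ (0 : ZMod p)),
      ← Finset.add_sum_erase Finset.univ (fun i => (starRingEnd ℂ) _)
        (Finset.mem_univ (0 : ZMod p)),
      Pi.mulSingle_eq_same] at this
    refine add_right_cancel (this.trans (congrArg _ (Finset.sum_congr rfl fun i hi => ?_)))
    rw [Pi.mulSingle_eq_of_ne (Finset.ne_of_mem_erase hi), hα1]
  · obtain ⟨s, m, hs, hαs⟩ := (hα.isChar.mul hα.conj.isChar).exists_eq_sum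
    have hαs' : α * conjChar α = ∑ β : s, m β • β.1 := by
      rw [hαs, Finset.sum_coe_sort s fun β => m β • β]
    have hcons := constituents_sum (m := fun β : s => m β) (fun β : s => (hs β β.2).1)
      Subtype.val_injective fun β => (hs β β.2).2
    rw [← hαs', Subtype.range_coe_subtype] at hcons
    have h1s : (1 : A → ℂ) ∈ s := by
      have : (1 : A → ℂ) ∈ constituents A (α * conjChar α) := by
        refine ⟨isIrrChar_one, ?_⟩
        have hαα := (isIrrChar_iff.mp hα).2
        have : charInner A 1 (α * conjChar α) = charInner A α α := by
          simp [charInner, conjChar, mul_comm]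
        rw [this, hαα]
        exact one_ne_zero
      rwa [hcons] at this
    have hs' : ∀ β ∈ s.erase 1, IsIrrChar A β := fun β hβ => (hs β (Finset.mem_of_mem_erase hβ)).1
    have hs1 : 1 ∉ s.erase 1 := Finset.notMem_erase 1 s
    rw [eta, eta, hcons, wreathInd_mul_conj h1s hαs, ncard_constituents_sum
      (isIrrChar_wreathConstituent hα hαne hs' hs1)
      (wreathConstituent_injective hp.one_lt hα hαne hs' hs1)]
    · have hc := Finset.card_pos.mpr ⟨_, h1s⟩
      have hp1 := hp.one_lt
      have hA : Fintype.card (AddChar (ZMod p) ℂ) = p := by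
        rw [← Nat.card_eq_fintype_card, Nat.card_eq_fintype_card, AddChar.card_eq, ZMod.card]
      simp only [Fintype.card_sum, hA, Fintype.card_coe, Finset.card_erase_of_mem h1s,
        Finset.card_erase_of_mem (Finset.mem_univ (0 : ZMod p)), Finset.card_univ, ZMod.card]
      rw [show {x | x ∈ s} = (s : Set (A → ℂ)) from rfl, Set.ncard_coe_finset]
      omega
    · rintro (ψ | β | j)
      exacts [(hs 1 h1s).2, (hs β (Finset.mem_of_mem_erase β.2)).2, one_ne_zero]
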